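/- arXiv:2511.18432 — 3 statements merged into one kernel-verified Lean document; each statement's English description precedes it below -/
import Mathlib

section
/- Under the permutation null distribution, for n ≥ 4 and every integer t with 1 ≤ t ≤ n−1, Cov(R_out,1(t), R_out,2(t)) = [t(t−1)(n−t)(n−t−1)/(n(n−1)(n−2)(n−3))] · { Σ_{u≠v} D_uv²/2 − (Σ_u D_u² − 4|G_out|²/n) − 2|G_out|²/(n(n−1)) }. -/
open scoped BigOperators Classical

noncomputable section

namespace CPD

/-- Nodes: `n` individuals, each with `ℓ` repeated measurements. -/
abbrev Node (n ℓ : ℕ) := Fin n × Fin ℓ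

/-- The (unordered) pair of individuals joined by an edge. -/
def indPair {n ℓ : ℕ} (e : Sym2 (Node n ℓ)) : Sym2 (Fin n) := Sym2.map Prod.fst e

/-- Between-individual edges of the graph `Gr`. -/
def Gout {n ℓ : ℕ} (Gr : Finset (Sym2 (Node n ℓ))) : Finset (Sym2 (Node n ℓ)) :=
  Gr.filter fun e => ¬ (indPair e).IsDiag

/-- Within-individual edges of the graph `Gr`. -/
def Gin {n ℓ : ℕ} (Gr : Finset (Sym2 (Node n ℓ))) : Finset (Sym2 (Node n ℓ)) :=
  Gr.filter fun e => (indPair e).IsDiag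

/-- `D Gr u v`: the number of edges of `Gr` between individual `u` and individual `v`
(for `u = v`, the number of within-individual edges of individual `u`). -/
def D {n ℓ : ℕ} (Gr : Finset (Sym2 (Node n ℓ))) (u v : Fin n) : ℕ :=
  (Gr.filter fun e => indPair e = s(u, v)).card

/-- `Ddeg Gr u = ∑_{v ≠ u} D Gr u v`. -/
def Ddeg {n ℓ : ℕ} (Gr : Finset (Sym2 (Node n ℓ))) (u : Fin n) : ℕ :=
  ∑ v ∈ Finset.univ.filter fun v => v ≠ u, D Gr u v

/-- Number of between-individual edges both of whose endpoints belong to individuals whose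
permuted label (in `{1, …, n}`) is `≤ t`. -/
def Rout1 {n ℓ : ℕ} (Gr : Finset (Sym2 (Node n ℓ))) (t : ℕ) (σ : Equiv.Perm (Fin n)) : ℕ :=
  ((Gout Gr).filter fun e => ∀ x ∈ e, ((σ x.1 : ℕ) + 1 ≤ t)).card

/-- Number of between-individual edges both of whose endpoints belong to individuals whose
permuted label is `> t`. -/
def Rout2 {n ℓ : ℕ} (Gr : Finset (Sym2 (Node n ℓ))) (t : ℕ) (σ : Equiv.Perm (Fin n)) : ℕ :=
  ((Gout Gr).filter fun e => ∀ x ∈ e, (t ≤ (σ x.1 : ℕ))).card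

/-- Number of within-individual edges both of whose endpoints belong to individuals whose
permuted label is `≤ t`. -/
def Rin1 {n ℓ : ℕ} (Gr : Finset (Sym2 (Node n ℓ))) (t : ℕ) (σ : Equiv.Perm (Fin n)) : ℕ :=
  ((Gin Gr).filter fun e => ∀ x ∈ e, ((σ x.1 : ℕ) + 1 ≤ t)).card

/-- Expectation under the permutation null distribution (uniform over the `n!` permutations of
the individual labels). -/
def pexp {n : ℕ} (f : Equiv.Perm (Fin n) → ℝ) : ℝ :=
  (∑ σ : Equiv.Perm (Fin n), f σ) / (Nat.factorial n)

/-- Covariance under the permutation null distribution. -/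
def pcov {n : ℕ} (f g : Equiv.Perm (Fin n) → ℝ) : ℝ :=
  pexp fun σ => (f σ - pexp f) * (g σ - pexp g)

/-- Variance under the permutation null distribution. -/
def pvar {n : ℕ} (f : Equiv.Perm (Fin n) → ℝ) : ℝ := pcov f f

/-- The weighted edge-count statistic
`R_out,w(t) = ((n−t−1)·R_out,1(t) + (t−1)·R_out,2(t))/(n−2)`. -/
def Routw {n ℓ : ℕ} (Gr : Finset (Sym2 (Node n ℓ))) (t : ℕ) (σ : Equiv.Perm (Fin n)) : ℝ :=
  (((n : ℝ) - t - 1) * (Rout1 Gr t σ : ℝ) + ((t : ℝ) - 1) * (Rout2 Gr t σ : ℝ)) / ((n : ℝ) - 2)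

/-- The difference edge-count statistic `R_out,d(t) = R_out,1(t) − R_out,2(t)`. -/
def Routd {n ℓ : ℕ} (Gr : Finset (Sym2 (Node n ℓ))) (t : ℕ) (σ : Equiv.Perm (Fin n)) : ℝ :=
  (Rout1 Gr t σ : ℝ) - (Rout2 Gr t σ : ℝ)

/-- Standardized weighted between-individual statistic `Z_out,w(t)`. -/
def Zoutw {n ℓ : ℕ} (Gr : Finset (Sym2 (Node n ℓ))) (t : ℕ) (σ : Equiv.Perm (Fin n)) : ℝ :=
  (Routw Gr t σ - pexp (Routw Gr t)) / Real.sqrt (pvar (Routw Gr t))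

/-- Standardized difference statistic `Z_out,d(t)`. -/
def Zoutd {n ℓ : ℕ} (Gr : Finset (Sym2 (Node n ℓ))) (t : ℕ) (σ : Equiv.Perm (Fin n)) : ℝ :=
  (Routd Gr t σ - pexp (Routd Gr t)) / Real.sqrt (pvar (Routd Gr t))

/-- Standardized within-individual statistic `Z_in(t)`. -/
def Zin {n ℓ : ℕ} (Gr : Finset (Sym2 (Node n ℓ))) (t : ℕ) (σ : Equiv.Perm (Fin n)) : ℝ :=
  ((Rin1 Gr t σ : ℝ) - pexp (fun τ => (Rin1 Gr t τ : ℝ))) /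
    Real.sqrt (pvar (fun τ => (Rin1 Gr t τ : ℝ)))

/-- The constant
`ϱ = (Σ_u D_uu·D_u − (2/n)|G_in||G_out|) / sqrt((Σ_u D_u² − 4|G_out|²/n)(Σ_u D_uu² − |G_in|²/n))`. -/
def varrho {n ℓ : ℕ} (Gr : Finset (Sym2 (Node n ℓ))) : ℝ :=
  ((∑ u : Fin n, (D Gr u u : ℝ) * (Ddeg Gr u : ℝ)) -
      2 / (n : ℝ) * ((Gin Gr).card : ℝ) * ((Gout Gr).card : ℝ)) /
    Real.sqrt (((∑ u : Fin n, (Ddeg Gr u : ℝ) ^ 2) - 4 * ((Gout Gr).card : ℝ) ^ 2 / (n : ℝ)) *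
      ((∑ u : Fin n, (D Gr u u : ℝ) ^ 2) - ((Gin Gr).card : ℝ) ^ 2 / (n : ℝ)))


/-- One-step recursion for moments of a uniform permutation: if `G` only depends on the images of
the points of `s` and forces `∑ i ∈ s, c (σ i) = k`, one more factor `c (σ y)` with `y ∉ s` can be
averaged out. -/
lemma sum_perm_mul_apply {n : ℕ} (c : Fin n → ℝ) (T k : ℝ) (hT : ∑ i, c i = T)
    (s : Finset (Fin n)) (G : Equiv.Perm (Fin n) → ℝ)
    (hG : ∀ y z, y ∉ s → z ∉ s → ∀ σ, G (σ * Equiv.swap y z) = G σ)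
    (hk : ∀ σ, G σ * ∑ i ∈ s, c (σ i) = k * G σ) (y : Fin n) (hy : y ∉ s) :
    ((n : ℝ) - s.card) * ∑ σ, G σ * c (σ y) = (T - k) * ∑ σ, G σ := by
  have hsymm : ∀ z ∈ sᶜ, ∑ σ, G σ * c (σ z) = ∑ σ, G σ * c (σ y) := by
    intro z hz
    rw [← Equiv.sum_comp (Equiv.mulRight (Equiv.swap y z)) fun σ => G σ * c (σ z)]
    refine Finset.sum_congr rfl fun σ _ => ?_
    simp [hG y z hy (Finset.mem_compl.1 hz)]
  have hcard : ((sᶜ.card : ℕ) : ℝ) = (n : ℝ) - s.card := by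
    rw [Finset.card_compl, Fintype.card_fin, Nat.cast_sub]
    simpa using Finset.card_le_univ s
  rw [← hcard, ← nsmul_eq_mul, ← Finset.sum_const, ← Finset.sum_congr rfl hsymm,
    Finset.sum_comm, Finset.mul_sum]
  refine Finset.sum_congr rfl fun σ _ => ?_
  have h1 : ∑ i, c (σ i) = T := by rw [Equiv.sum_comp σ c, hT]
  have h2 := Finset.sum_add_sum_compl s fun i => c (σ i)
  rw [← Finset.mul_sum]
  linear_combination G σ * h1 + G σ * h2 - hk σ

lemma sum_perm_pair {n : ℕ} (c : Fin n → ℝ) (T : ℝ) (hT : ∑ i, c i = T)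
    (hc : ∀ i, c i * c i = c i) {u v : Fin n} (huv : u ≠ v) :
    (n : ℝ) * ((n : ℝ) - 1) * ∑ σ : Equiv.Perm (Fin n), c (σ u) * c (σ v) =
      T * (T - 1) * (Nat.factorial n) := by
  have h1 := sum_perm_mul_apply c T 0 hT ∅ (fun _ => 1) (by simp) (by simp) u (by simp)
  have h2 := sum_perm_mul_apply c T 1 hT {u} (fun σ => c (σ u))
    (fun y z hy hz σ => by
      simp only [Finset.mem_singleton] at hy hz
      simp [Equiv.swap_apply_of_ne_of_ne (Ne.symm hy) (Ne.symm hz)])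
    (fun σ => by simp [hc]) v (by simpa using huv.symm)
  simp [Fintype.card_perm] at h1 h2
  linear_combination (n : ℝ) * h2 + (T - 1) * h1

lemma sum_perm_quad {n : ℕ} (a b : Fin n → ℝ) (A B : ℝ) (hA : ∑ i, a i = A) (hB : ∑ i, b i = B)
    (ha : ∀ i, a i * a i = a i) (hb : ∀ i, b i * b i = b i) (hab : ∀ i, a i * b i = 0)
    {u v x y : Fin n} (huv : u ≠ v) (hxy : x ≠ y)
    (hux : u ≠ x) (huy : u ≠ y) (hvx : v ≠ x) (hvy : v ≠ y) :
    (n : ℝ) * ((n : ℝ) - 1) * ((n : ℝ) - 2) * ((n : ℝ) - 3) *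
        ∑ σ : Equiv.Perm (Fin n), a (σ u) * a (σ v) * (b (σ x) * b (σ y)) =
      A * (A - 1) * B * (B - 1) * (Nat.factorial n) := by
  have h2 := sum_perm_pair a A hA ha huv
  have h3 := sum_perm_mul_apply b B 0 hB {u, v} (fun σ => a (σ u) * a (σ v))
    (fun y z hy hz σ => by
      simp only [Finset.mem_insert, Finset.mem_singleton, not_or] at hy hz
      simp [Equiv.swap_apply_of_ne_of_ne (Ne.symm hy.1) (Ne.symm hz.1),
        Equiv.swap_apply_of_ne_of_ne (Ne.symm hy.2) (Ne.symm hz.2)])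
    (fun σ => by
      rw [Finset.sum_pair huv]
      linear_combination a (σ v) * hab (σ u) + a (σ u) * hab (σ v))
    x (by simp [hux.symm, hvx.symm])
  have h4 := sum_perm_mul_apply b B 1 hB {u, v, x} (fun σ => a (σ u) * a (σ v) * b (σ x))
    (fun y z hy hz σ => by
      simp only [Finset.mem_insert, Finset.mem_singleton, not_or] at hy hz
      simp [Equiv.swap_apply_of_ne_of_ne (Ne.symm hy.1) (Ne.symm hz.1),
        Equiv.swap_apply_of_ne_of_ne (Ne.symm hy.2.1) (Ne.symm hz.2.1),
        Equiv.swap_apply_of_ne_of_ne (Ne.symm hy.2.2) (Ne.symm hz.2.2)])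
    (fun σ => by
      rw [Finset.sum_insert (by simp [huv, hux]), Finset.sum_pair hvx]
      linear_combination a (σ v) * b (σ x) * hab (σ u) + a (σ u) * b (σ x) * hab (σ v)
        + a (σ u) * a (σ v) * hb (σ x))
    y (by simp [huy.symm, hvy.symm, hxy.symm])
  have hc2 : ((({u, v} : Finset (Fin n)).card : ℕ) : ℝ) = 2 := by
    rw [Finset.card_pair huv]; norm_num
  have hc3 : ((({u, v, x} : Finset (Fin n)).card : ℕ) : ℝ) = 3 := by
    rw [Finset.card_eq_three.2 ⟨u, v, x, huv, hux, hvx, rfl⟩]; norm_num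
  rw [hc2] at h3
  rw [hc3] at h4
  simp only [← mul_assoc]
  linear_combination (n : ℝ) * (n - 1) * (n - 2) * h4 + (n : ℝ) * (n - 1) * (B - 1) * h3
    + B * (B - 1) * h2

/-- The weighted number of ordered pairs of disjoint edges, by inclusion-exclusion. -/
lemma sum_disjoint_pairs {ι : Type*} [Fintype ι] [DecidableEq ι] (W : ι → ι → ℝ)
    (hs : ∀ u v, W u v = W v u) :
    ∑ u, ∑ v, ∑ x, ∑ y, W u v * W x y *
        (1 - (if u = x then 1 else 0) - (if u = y then 1 else 0)
          - (if v = x then 1 else 0) - (if v = y then 1 else 0)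
          + (if u = x then 1 else 0) * (if v = y then 1 else 0)
          + (if u = y then 1 else 0) * (if v = x then 1 else 0)) =
      (∑ u, ∑ v, W u v) ^ 2 - 4 * ∑ u, (∑ v, W u v) ^ 2 + 2 * ∑ u, ∑ v, W u v ^ 2 := by
  have hr : ∀ v, ∑ u, W u v = ∑ u, W v u := fun v => Finset.sum_congr rfl fun u _ => hs u v
  have inner : ∀ u v, ∑ x, ∑ y, W u v * W x y *
        (1 - (if u = x then 1 else 0) - (if u = y then 1 else 0)
          - (if v = x then 1 else 0) - (if v = y then 1 else 0)
          + (if u = x then 1 else 0) * (if v = y then 1 else 0)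
          + (if u = y then 1 else 0) * (if v = x then 1 else 0)) =
      W u v * (∑ x, ∑ y, W x y) - 2 * (W u v * ∑ y, W u y) - 2 * (W u v * ∑ y, W v y)
        + 2 * W u v ^ 2 := by
    intro u v
    simp only [mul_add, mul_sub, Finset.sum_add_distrib, Finset.sum_sub_distrib, mul_ite,
      mul_one, mul_zero, Finset.sum_ite_eq, Finset.mem_univ, if_true,
      Finset.sum_ite_irrel, Finset.sum_const_zero, ← Finset.mul_sum, hr]
    rw [hs v u]
    ring
  simp only [inner, Finset.sum_add_distrib, Finset.sum_sub_distrib, ← Finset.mul_sum,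
    ← Finset.sum_mul]
  have h3 : ∑ u, ∑ v, W u v * ∑ y, W v y = ∑ u, (∑ v, W u v) ^ 2 := by
    rw [Finset.sum_comm]
    simp only [← Finset.sum_mul, hr, sq]
  rw [h3]
  simp only [sq]
  ring

/-- The matrix of between-individual edge counts, with zero diagonal. -/
def offD {n ℓ : ℕ} (Gr : Finset (Sym2 (Node n ℓ))) (u v : Fin n) : ℝ :=
  if v ≠ u then (D Gr u v : ℝ) else 0

lemma offD_symm {n ℓ : ℕ} (Gr : Finset (Sym2 (Node n ℓ))) (u v : Fin n) :
    offD Gr u v = offD Gr v u := by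
  simp only [offD, D, ne_comm, Sym2.eq_swap]

lemma offD_self {n ℓ : ℕ} (Gr : Finset (Sym2 (Node n ℓ))) (u : Fin n) : offD Gr u u = 0 := by
  simp [offD]

lemma Ddeg_eq_sum_offD {n ℓ : ℕ} (Gr : Finset (Sym2 (Node n ℓ))) (u : Fin n) :
    (Ddeg Gr u : ℝ) = ∑ v, offD Gr u v := by
  simp only [Ddeg, offD, Finset.sum_filter, Nat.cast_sum, Nat.cast_ite, Nat.cast_zero]

lemma sum_D_sq_eq_sum_offD {n ℓ : ℕ} (Gr : Finset (Sym2 (Node n ℓ))) :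
    (∑ u : Fin n, ∑ v ∈ Finset.univ.filter fun v => v ≠ u, (D Gr u v : ℝ) ^ 2 / 2) =
      (∑ u, ∑ v, offD Gr u v ^ 2) / 2 := by
  simp only [Finset.sum_filter, Finset.sum_div]
  refine Finset.sum_congr rfl fun u _ => Finset.sum_congr rfl fun v _ => ?_
  by_cases h : v = u <;> simp [offD, h]

lemma offD_eq_sum_Gout {n ℓ : ℕ} (Gr : Finset (Sym2 (Node n ℓ))) (u v : Fin n) :
    offD Gr u v = ∑ e ∈ Gout Gr, if indPair e = s(u, v) then 1 else 0 := by
  rw [Finset.sum_boole, Gout, Finset.filter_filter, offD, D]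
  by_cases h : v = u
  · subst h
    simp only [ne_eq, not_true_eq_false, if_false]
    rw [Finset.filter_false_of_mem, Finset.card_empty, Nat.cast_zero]
    rintro e - ⟨h1, h2⟩
    simp [h2] at h1
  · rw [if_pos h]
    congr 2
    refine Finset.filter_congr fun e _ => ⟨fun h2 => ⟨?_, h2⟩, fun h2 => h2.2⟩
    rw [h2, Sym2.mk_isDiag_iff]
    exact Ne.symm h

lemma sum_sum_eq_mk {n : ℕ} (p : Sym2 (Fin n)) (hp : ¬ p.IsDiag) (f : Sym2 (Fin n) → ℝ) :
    ∑ u, ∑ v, (if p = s(u, v) then 1 else 0) * f s(u, v) = 2 * f p := by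
  induction p using Sym2.ind with
  | _ x y =>
    have hxy : x ≠ y := by simpa using hp
    have key : ∀ u v, (if s(x, y) = s(u, v) then (1 : ℝ) else 0) * f s(u, v) =
        (if x = u then if y = v then f s(x, y) else 0 else 0)
          + (if y = u then if x = v then f s(x, y) else 0 else 0) := by
      intro u v
      simp only [Sym2.eq_iff]
      by_cases h1 : x = u ∧ y = v
      · obtain ⟨rfl, rfl⟩ := h1
        simp [hxy]
      · by_cases h2 : x = v ∧ y = u
        · obtain ⟨rfl, rfl⟩ := h2
          simp [hxy, Sym2.eq_swap]
        · rw [if_neg (by tauto)]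
          split_ifs <;> first | (exfalso; tauto) | simp
    simp only [key, Finset.sum_add_distrib, Finset.sum_ite_irrel, Finset.sum_ite_eq,
      Finset.mem_univ, if_true, Finset.sum_const_zero]
    ring

lemma sum_Gout {n ℓ : ℕ} (Gr : Finset (Sym2 (Node n ℓ))) (f : Sym2 (Fin n) → ℝ) :
    ∑ e ∈ Gout Gr, f (indPair e) = (∑ u, ∑ v, offD Gr u v * f s(u, v)) / 2 := by
  simp only [offD_eq_sum_Gout, Finset.sum_mul]
  have h : ∀ u : Fin n, ∑ v, ∑ e ∈ Gout Gr, (if indPair e = s(u, v) then 1 else 0) * f s(u, v) =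
      ∑ e ∈ Gout Gr, ∑ v, (if indPair e = s(u, v) then 1 else 0) * f s(u, v) :=
    fun u => Finset.sum_comm
  simp only [h]
  rw [Finset.sum_comm, Finset.sum_congr rfl fun e (he : e ∈ Gout Gr) =>
    sum_sum_eq_mk (indPair e) (Finset.mem_filter.1 he).2 f, ← Finset.mul_sum]
  ring

lemma card_Gout_filter {n ℓ : ℕ} (Gr : Finset (Sym2 (Node n ℓ))) (P : Fin n → Prop)
    [DecidablePred fun e : Sym2 (Node n ℓ) => ∀ x ∈ e, P x.1] (c : Fin n → ℝ)
    (h1 : ∀ u, P u → c u = 1) (h0 : ∀ u, ¬ P u → c u = 0) :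
    (((Gout Gr).filter fun e => ∀ x ∈ e, P x.1).card : ℝ) =
      (∑ u, ∑ v, offD Gr u v * (c u * c v)) / 2 := by
  have h := sum_Gout Gr fun p => if ∀ u ∈ p, P u then 1 else 0
  have hl : ∀ e : Sym2 (Node n ℓ), (∀ u ∈ indPair e, P u) ↔ ∀ x ∈ e, P x.1 := by
    intro e
    simp only [indPair, Sym2.mem_map]
    aesop
  have hr : ∀ u v, (if ∀ w ∈ s(u, v), P w then (1 : ℝ) else 0) = c u * c v := by
    intro u v
    by_cases hu : P u <;> by_cases hv : P v <;> simp [hu, hv, h1, h0]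
  simp only [hr, hl] at h
  rw [← h, Finset.natCast_card_filter]

lemma card_Gout {n ℓ : ℕ} (Gr : Finset (Sym2 (Node n ℓ))) :
    ((Gout Gr).card : ℝ) = (∑ u, ∑ v, offD Gr u v) / 2 := by
  simpa using sum_Gout Gr fun _ => 1

lemma pcov_eq {n : ℕ} (f g : Equiv.Perm (Fin n) → ℝ) :
    pcov f g = pexp (fun σ => f σ * g σ) - pexp f * pexp g := by
  have hn : (Nat.factorial n : ℝ) ≠ 0 := by exact_mod_cast Nat.factorial_ne_zero n
  have h : ∀ p q : ℝ, ∑ σ, (f σ - p) * (g σ - q) =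
      ∑ σ, f σ * g σ - q * ∑ σ, f σ - p * ∑ σ, g σ + (Nat.factorial n) * (p * q) := by
    intro p q
    have : ((Nat.factorial n : ℕ) : ℝ) * (p * q) = ∑ _σ : Equiv.Perm (Fin n), p * q := by
      simp [Fintype.card_perm]
    rw [this, Finset.mul_sum, Finset.mul_sum, ← Finset.sum_sub_distrib, ← Finset.sum_sub_distrib,
      ← Finset.sum_add_distrib]
    exact Finset.sum_congr rfl fun σ _ => by ring
  rw [pcov]
  simp only [pexp, h]
  field_simp
  ring

lemma pexp_quadratic {n : ℕ} (hn : 4 ≤ n) (W : Fin n → Fin n → ℝ) (hW : ∀ u, W u u = 0)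
    (c : Fin n → ℝ) (T : ℝ) (hT : ∑ i, c i = T) (hc : ∀ i, c i * c i = c i) :
    pexp (fun σ => (∑ u, ∑ v, W u v * (c (σ u) * c (σ v))) / 2) =
      T * (T - 1) / ((n : ℝ) * (n - 1)) * ((∑ u, ∑ v, W u v) / 2) := by
  have hn' : (4 : ℝ) ≤ n := by exact_mod_cast hn
  have h0 : (n : ℝ) ≠ 0 := by linarith
  have h1 : (n : ℝ) - 1 ≠ 0 := by linarith
  have hf : (Nat.factorial n : ℝ) ≠ 0 := by exact_mod_cast Nat.factorial_ne_zero n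
  have key : ∑ σ : Equiv.Perm (Fin n), ∑ u, ∑ v, W u v * (c (σ u) * c (σ v)) =
      T * (T - 1) / ((n : ℝ) * (n - 1)) * (Nat.factorial n) * (∑ u, ∑ v, W u v) := by
    rw [Finset.sum_comm, Finset.mul_sum]
    refine Finset.sum_congr rfl fun u _ => ?_
    rw [Finset.sum_comm, Finset.mul_sum]
    refine Finset.sum_congr rfl fun v _ => ?_
    rw [← Finset.mul_sum]
    by_cases huv : u = v
    · subst huv; simp [hW]
    · have h := sum_perm_pair c T hT hc huv
      field_simp
      linear_combination W u v * h
  rw [pexp, ← Finset.sum_div, key]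
  field_simp

lemma pexp_quadratic_mul {n : ℕ} (hn : 4 ≤ n) (W : Fin n → Fin n → ℝ)
    (hs : ∀ u v, W u v = W v u) (hW : ∀ u, W u u = 0)
    (a b : Fin n → ℝ) (A B : ℝ) (hA : ∑ i, a i = A) (hB : ∑ i, b i = B)
    (ha : ∀ i, a i * a i = a i) (hb : ∀ i, b i * b i = b i) (hab : ∀ i, a i * b i = 0) :
    pexp (fun σ => (∑ u, ∑ v, W u v * (a (σ u) * a (σ v))) / 2 *
        ((∑ u, ∑ v, W u v * (b (σ u) * b (σ v))) / 2)) =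
      A * (A - 1) * B * (B - 1) / ((n : ℝ) * (n - 1) * (n - 2) * (n - 3)) *
        (((∑ u, ∑ v, W u v) ^ 2 - 4 * ∑ u, (∑ v, W u v) ^ 2 + 2 * ∑ u, ∑ v, W u v ^ 2) / 4) := by
  have hn' : (4 : ℝ) ≤ n := by exact_mod_cast hn
  have h0 : (n : ℝ) ≠ 0 := by linarith
  have h1 : (n : ℝ) - 1 ≠ 0 := by linarith
  have h2 : (n : ℝ) - 2 ≠ 0 := by linarith
  have h3 : (n : ℝ) - 3 ≠ 0 := by linarith
  have hf : (Nat.factorial n : ℝ) ≠ 0 := by exact_mod_cast Nat.factorial_ne_zero n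
  have key : ∑ σ : Equiv.Perm (Fin n), (∑ u, ∑ v, W u v * (a (σ u) * a (σ v))) *
        (∑ x, ∑ y, W x y * (b (σ x) * b (σ y))) =
      A * (A - 1) * B * (B - 1) / ((n : ℝ) * (n - 1) * (n - 2) * (n - 3)) * (Nat.factorial n) *
        ((∑ u, ∑ v, W u v) ^ 2 - 4 * ∑ u, (∑ v, W u v) ^ 2 + 2 * ∑ u, ∑ v, W u v ^ 2) := by
    rw [← sum_disjoint_pairs W hs]
    simp only [Finset.sum_mul]
    simp only [Finset.mul_sum]
    rw [Finset.sum_comm]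
    refine Finset.sum_congr rfl fun u _ => ?_
    rw [Finset.sum_comm]
    refine Finset.sum_congr rfl fun v _ => ?_
    rw [Finset.sum_comm]
    refine Finset.sum_congr rfl fun x _ => ?_
    rw [Finset.sum_comm]
    refine Finset.sum_congr rfl fun y _ => ?_
    by_cases huv : u = v
    · subst huv; simp [hW]
    by_cases hxy : x = y
    · subst hxy; simp [hW]
    by_cases hd : u = x ∨ u = y ∨ v = x ∨ v = y
    · have hzero : ∀ σ : Equiv.Perm (Fin n),
          W u v * (a (σ u) * a (σ v)) * (W x y * (b (σ x) * b (σ y))) = 0 := by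
        intro σ
        rcases hd with rfl | rfl | rfl | rfl
        · linear_combination W u v * a (σ v) * W u y * b (σ y) * hab (σ u)
        · linear_combination W u v * a (σ v) * W x u * b (σ x) * hab (σ u)
        · linear_combination W u v * a (σ u) * W v y * b (σ y) * hab (σ v)
        · linear_combination W u v * a (σ u) * W x v * b (σ x) * hab (σ v)
      rw [Finset.sum_eq_zero fun σ _ => hzero σ]
      symm
      convert mul_zero _
      convert mul_zero _
      split_ifs <;> first | (exfalso; grind) | norm_num
    · push Not at hd
      obtain ⟨hux, huy, hvx, hvy⟩ := hd
      have h := sum_perm_quad a b A B hA hB ha hb hab huv hxy hux huy hvx hvy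
      have hpull : ∑ σ : Equiv.Perm (Fin n),
          W u v * (a (σ u) * a (σ v)) * (W x y * (b (σ x) * b (σ y))) =
          W u v * W x y * ∑ σ : Equiv.Perm (Fin n),
            a (σ u) * a (σ v) * (b (σ x) * b (σ y)) := by
        rw [Finset.mul_sum]
        exact Finset.sum_congr rfl fun σ _ => by ring
      rw [hpull]
      simp only [hux, huy, hvx, hvy, if_false]
      generalize ∑ σ : Equiv.Perm (Fin n), a (σ u) * a (σ v) * (b (σ x) * b (σ y)) = S at h ⊢
      field_simp
      linear_combination W u v * W x y * h
  have hmul : ∀ p q : ℝ, p / 2 * (q / 2) = p * q / 4 := fun p q => by ring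
  simp only [pexp, hmul]
  rw [← Finset.sum_div, key]
  field_simp

lemma sum_indicator_lt {n t : ℕ} (ht : t ≤ n) :
    ∑ i : Fin n, (if (i : ℕ) + 1 ≤ t then (1 : ℝ) else 0) = t := by
  rw [Fin.sum_univ_eq_sum_range (fun i => if i + 1 ≤ t then (1 : ℝ) else 0) n, Finset.sum_boole]
  congr 1
  rw [show (Finset.range n).filter (fun i => i + 1 ≤ t) = Finset.range t by
    ext i; simp only [Finset.mem_filter, Finset.mem_range]; omega, Finset.card_range]

lemma sum_indicator_ge {n t : ℕ} (ht : t ≤ n) :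
    ∑ i : Fin n, (if t ≤ (i : ℕ) then (1 : ℝ) else 0) = (n : ℝ) - t := by
  rw [eq_sub_iff_add_eq, ← sum_indicator_lt ht, ← Finset.sum_add_distrib]
  rw [Finset.sum_congr rfl fun i _ => show _ = (1 : ℝ) by split_ifs <;> first | omega | norm_num]
  simp

/-- Covariance of `R_out,1(t)` and `R_out,2(t)` under the permutation null
distribution. -/
theorem cov_Rout1_Rout2 (n ℓ : ℕ) (Gr : Finset (Sym2 (Node n ℓ)))
    (hG : ∀ e ∈ Gr, ¬ e.IsDiag) (hn : 4 ≤ n) (t : ℕ) (ht1 : 1 ≤ t) (ht2 : t ≤ n - 1) :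
    pcov (fun σ => (Rout1 Gr t σ : ℝ)) (fun σ => (Rout2 Gr t σ : ℝ)) =
      (t : ℝ) * ((t : ℝ) - 1) * ((n : ℝ) - t) * ((n : ℝ) - t - 1) /
          ((n : ℝ) * ((n : ℝ) - 1) * ((n : ℝ) - 2) * ((n : ℝ) - 3)) *
        ((∑ u : Fin n, ∑ v ∈ Finset.univ.filter fun v => v ≠ u, (D Gr u v : ℝ) ^ 2 / 2) -
          ((∑ u : Fin n, (Ddeg Gr u : ℝ) ^ 2) - 4 * ((Gout Gr).card : ℝ) ^ 2 / (n : ℝ)) -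
          2 / ((n : ℝ) * ((n : ℝ) - 1)) * ((Gout Gr).card : ℝ) ^ 2) := by
  have hn' : (4 : ℝ) ≤ n := by exact_mod_cast hn
  have h0 : (n : ℝ) ≠ 0 := by linarith
  have h1 : (n : ℝ) - 1 ≠ 0 := by linarith
  have h2 : (n : ℝ) - 2 ≠ 0 := by linarith
  have h3 : (n : ℝ) - 3 ≠ 0 := by linarith
  have htn : t ≤ n := by omega
  obtain ⟨a, ha⟩ : ∃ a : Fin n → ℝ, ∀ i, a i = if (i : ℕ) + 1 ≤ t then 1 else 0 :=
    ⟨_, fun _ => rfl⟩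
  obtain ⟨b, hb⟩ : ∃ b : Fin n → ℝ, ∀ i, b i = if t ≤ (i : ℕ) then 1 else 0 :=
    ⟨_, fun _ => rfl⟩
  have hA : ∑ i, a i = t := by simp only [ha, sum_indicator_lt htn]
  have hB : ∑ i, b i = (n : ℝ) - t := by simp only [hb, sum_indicator_ge htn]
  have haa : ∀ i, a i * a i = a i := fun i => by rw [ha]; split_ifs <;> norm_num
  have hbb : ∀ i, b i * b i = b i := fun i => by rw [hb]; split_ifs <;> norm_num
  have hab : ∀ i, a i * b i = 0 := fun i => by
    rw [ha, hb]; split_ifs <;> first | omega | norm_num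
  have hR1 : ∀ σ : Equiv.Perm (Fin n), (Rout1 Gr t σ : ℝ) =
      (∑ u, ∑ v, offD Gr u v * (a (σ u) * a (σ v))) / 2 := fun σ =>
    card_Gout_filter Gr (fun u => (σ u : ℕ) + 1 ≤ t) (fun u => a (σ u))
      (fun u hu => by rw [ha, if_pos hu]) (fun u hu => by rw [ha, if_neg hu])
  have hR2 : ∀ σ : Equiv.Perm (Fin n), (Rout2 Gr t σ : ℝ) =
      (∑ u, ∑ v, offD Gr u v * (b (σ u) * b (σ v))) / 2 := fun σ =>
    card_Gout_filter Gr (fun u => t ≤ (σ u : ℕ)) (fun u => b (σ u))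
      (fun u hu => by rw [hb, if_pos hu]) (fun u hu => by rw [hb, if_neg hu])
  rw [pcov_eq]
  simp only [hR1, hR2]
  rw [pexp_quadratic hn (offD Gr) (offD_self Gr) a t hA haa,
    pexp_quadratic hn (offD Gr) (offD_self Gr) b (n - t) hB hbb,
    pexp_quadratic_mul hn (offD Gr) (offD_symm Gr) (offD_self Gr) a b t (n - t) hA hB haa hbb hab,
    sum_D_sq_eq_sum_offD, card_Gout]
  simp only [Ddeg_eq_sum_offD]
  generalize ∑ u, ∑ v, offD Gr u v = S
  generalize ∑ u, (∑ v, offD Gr u v) ^ 2 = Q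
  generalize ∑ u, ∑ v, offD Gr u v ^ 2 = R
  field_simp
  ring

end CPD
end
end

section
/- Under the permutation null distribution, for n ≥ 4 and every integer t with 1 ≤ t ≤ n−1, the weighted between-individual edge-count statistic and the within-individual edge-count statistic are uncorrelated: Cov(R_out,w(t), R_in,1(t)) = 0. -/
open scoped BigOperators Classical

noncomputable section

namespace CPD

/-- Indicator that the permuted label (in `{1, …, n}`) of individual `u` is `≤ t`. -/
def lowLabel {n : ℕ} (t : ℕ) (σ : Equiv.Perm (Fin n)) (u : Fin n) : ℝ :=
  if (σ u : ℕ) < t then 1 else 0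

lemma lowLabel_mul_self {n : ℕ} (t : ℕ) (σ : Equiv.Perm (Fin n)) (u : Fin n) :
    lowLabel t σ u * lowLabel t σ u = lowLabel t σ u := by
  unfold lowLabel; split_ifs <;> simp

lemma sum_lowLabel {n t : ℕ} (ht : t ≤ n) (σ : Equiv.Perm (Fin n)) :
    ∑ u, lowLabel t σ u = t := by
  have h : ∑ u, lowLabel t σ u = ∑ i : Fin n, if (i : ℕ) < t then (1 : ℝ) else 0 :=
    Equiv.sum_comp σ fun i : Fin n => if (i : ℕ) < t then (1 : ℝ) else 0
  rw [h, Finset.sum_boole, Fin.card_filter_val_lt, min_eq_right ht]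

/-- If `F` is invariant under transpositions of individuals outside `S`, then all individuals
outside `S` contribute equally to `∑ u, ∑ σ, F σ * lowLabel t σ u = t * ∑ σ, F σ`. -/
lemma sum_mul_lowLabel {n t : ℕ} (ht : t ≤ n) (S : Finset (Fin n))
    (F : Equiv.Perm (Fin n) → ℝ)
    (hF : ∀ a ∉ S, ∀ b ∉ S, ∀ σ, F (σ * Equiv.swap a b) = F σ) {w : Fin n} (hw : w ∉ S) :
    ∑ u ∈ S, ∑ σ, F σ * lowLabel t σ u + ((n : ℝ) - S.card) * ∑ σ, F σ * lowLabel t σ w =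
      t * ∑ σ, F σ := by
  have hconst : ∀ u ∈ Sᶜ, ∑ σ, F σ * lowLabel t σ u = ∑ σ, F σ * lowLabel t σ w := by
    intro u hu
    rw [Finset.mem_compl] at hu
    rw [← Equiv.sum_comp (Equiv.mulRight (Equiv.swap u w))]
    refine Finset.sum_congr rfl fun σ _ => ?_
    simp [hF u hu w hw, lowLabel]
  have hcard : ((Sᶜ.card : ℕ) : ℝ) = (n : ℝ) - S.card := by
    rw [Finset.card_compl, Fintype.card_fin, Nat.cast_sub]
    simpa using S.card_le_univ
  have htotal : ∑ u, ∑ σ, F σ * lowLabel t σ u = t * ∑ σ, F σ := by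
    rw [Finset.sum_comm, Finset.mul_sum]
    refine Finset.sum_congr rfl fun σ _ => ?_
    rw [← Finset.mul_sum, sum_lowLabel ht, mul_comm]
  rw [← htotal, ← Finset.sum_add_sum_compl S, Finset.sum_congr rfl hconst, Finset.sum_const,
    nsmul_eq_mul, hcard]

lemma sum_perm_lowLabel {n t : ℕ} (ht : t ≤ n) (w : Fin n) :
    (n : ℝ) * ∑ σ, lowLabel t σ w = t * (n.factorial : ℝ) := by
  have h := sum_mul_lowLabel ht ∅ (fun _ => 1) (by simp) (Finset.notMem_empty w)
  simpa [Fintype.card_perm] using h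

lemma sum_perm_lowLabel_mul {n t : ℕ} (ht : t ≤ n) {u v : Fin n} (huv : u ≠ v) :
    ((n : ℝ) - 1) * ∑ σ, lowLabel t σ u * lowLabel t σ v =
      ((t : ℝ) - 1) * ∑ σ, lowLabel t σ u := by
  have h := sum_mul_lowLabel ht {u} (fun σ => lowLabel t σ u)
    (fun a ha b hb σ => by
      rw [Finset.notMem_singleton] at ha hb
      simp [lowLabel, Equiv.swap_apply_of_ne_of_ne ha.symm hb.symm])
    (Finset.notMem_singleton.2 huv.symm)
  simp only [Finset.sum_singleton, lowLabel_mul_self, Finset.card_singleton, Nat.cast_one] at h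
  linarith

lemma sum_perm_lowLabel_mul_mul {n t : ℕ} (ht : t ≤ n) {u v w : Fin n} (huv : u ≠ v)
    (hwu : w ≠ u) (hwv : w ≠ v) :
    ((n : ℝ) - 2) * ∑ σ, lowLabel t σ u * lowLabel t σ v * lowLabel t σ w =
      ((t : ℝ) - 2) * ∑ σ, lowLabel t σ u * lowLabel t σ v := by
  have h := sum_mul_lowLabel ht {u, v} (fun σ => lowLabel t σ u * lowLabel t σ v)
    (fun a ha b hb σ => by
      simp only [Finset.mem_insert, Finset.mem_singleton, not_or] at ha hb
      simp [lowLabel, Equiv.swap_apply_of_ne_of_ne (Ne.symm ha.1) (Ne.symm hb.1),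
        Equiv.swap_apply_of_ne_of_ne (Ne.symm ha.2) (Ne.symm hb.2)])
    (w := w) (by simp [hwu, hwv])
  have h₁ : ∀ σ, lowLabel t σ u * lowLabel t σ v * lowLabel t σ u =
      lowLabel t σ u * lowLabel t σ v := fun σ => by
    rw [mul_right_comm, lowLabel_mul_self]
  have h₂ : ∀ σ, lowLabel t σ u * lowLabel t σ v * lowLabel t σ v =
      lowLabel t σ u * lowLabel t σ v := fun σ => by
    rw [mul_assoc, lowLabel_mul_self]
  simp only [Finset.sum_pair huv, h₁, h₂, Finset.card_pair huv, Nat.cast_ofNat] at h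
  linarith

/-- `n - 2` times the contribution to `Routw` of an edge between individuals `u` and `v`. -/
def pairWeight {n : ℕ} (t : ℕ) (σ : Equiv.Perm (Fin n)) (u v : Fin n) : ℝ :=
  ((n : ℝ) - t - 1) * (lowLabel t σ u * lowLabel t σ v) +
    ((t : ℝ) - 1) * ((1 - lowLabel t σ u) * (1 - lowLabel t σ v))

lemma pairWeight_comm {n : ℕ} (t : ℕ) (σ : Equiv.Perm (Fin n)) (u v : Fin n) :
    pairWeight t σ u v = pairWeight t σ v u := by
  unfold pairWeight; ring

lemma sum_pairWeight {n : ℕ} (t : ℕ) (u v : Fin n) :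
    ∑ σ, pairWeight t σ u v =
      ((n : ℝ) - 2) * ∑ σ, lowLabel t σ u * lowLabel t σ v +
        ((t : ℝ) - 1) * (n.factorial - ∑ σ, lowLabel t σ u - ∑ σ, lowLabel t σ v) := by
  have hone : (n.factorial : ℝ) = ∑ _σ : Equiv.Perm (Fin n), (1 : ℝ) := by
    simp [Fintype.card_perm]
  rw [hone, Finset.mul_sum, ← Finset.sum_sub_distrib, ← Finset.sum_sub_distrib, Finset.mul_sum,
    ← Finset.sum_add_distrib]
  exact Finset.sum_congr rfl fun σ _ => by unfold pairWeight; ring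

lemma sum_pairWeight_mul_lowLabel_left {n t : ℕ} (hn : n ≠ 0) (ht : t ≤ n) {u v : Fin n}
    (huv : u ≠ v) :
    (n : ℝ) * ∑ σ, pairWeight t σ u v * lowLabel t σ u = t * ∑ σ, pairWeight t σ u v := by
  have hn' : (n : ℝ) ≠ 0 := Nat.cast_ne_zero.2 hn
  have hu := sum_perm_lowLabel ht u
  have hA : ∑ σ, lowLabel t σ v = ∑ σ, lowLabel t σ u :=
    mul_left_cancel₀ hn' ((sum_perm_lowLabel ht v).trans hu.symm)
  have hB := sum_perm_lowLabel_mul ht huv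
  have hW : ∑ σ, pairWeight t σ u v * lowLabel t σ u =
      ((n : ℝ) - t - 1) * ∑ σ, lowLabel t σ u * lowLabel t σ v := by
    rw [Finset.mul_sum]
    refine Finset.sum_congr rfl fun σ _ => ?_
    unfold pairWeight
    linear_combination (((n : ℝ) - t - 1) * lowLabel t σ v -
      ((t : ℝ) - 1) * (1 - lowLabel t σ v)) * lowLabel_mul_self t σ u
  rw [hW, sum_pairWeight, hA]
  linear_combination ((n : ℝ) - 2 * t) * hB + ((t : ℝ) - 1) * hu

lemma sum_pairWeight_mul_lowLabel {n t : ℕ} (hn : n ≠ 0) (ht : t ≤ n) {u v : Fin n}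
    (huv : u ≠ v) (w : Fin n) :
    (n : ℝ) * ∑ σ, pairWeight t σ u v * lowLabel t σ w = t * ∑ σ, pairWeight t σ u v := by
  rcases eq_or_ne w u with rfl | hwu
  · exact sum_pairWeight_mul_lowLabel_left hn ht huv
  rcases eq_or_ne w v with rfl | hwv
  · simp only [pairWeight_comm t _ u w]
    exact sum_pairWeight_mul_lowLabel_left hn ht huv.symm
  have hn' : (n : ℝ) ≠ 0 := Nat.cast_ne_zero.2 hn
  have hw := sum_perm_lowLabel ht w
  have hA : ∀ z : Fin n, ∑ σ, lowLabel t σ z = ∑ σ, lowLabel t σ w := fun z =>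
    mul_left_cancel₀ hn' ((sum_perm_lowLabel ht z).trans hw.symm)
  have hB := sum_perm_lowLabel_mul ht huv
  have hBu := sum_perm_lowLabel_mul ht hwu.symm
  have hBv := sum_perm_lowLabel_mul ht hwv.symm
  have hC := sum_perm_lowLabel_mul_mul ht huv hwu hwv
  have hW : ∑ σ, pairWeight t σ u v * lowLabel t σ w =
      ((n : ℝ) - 2) * ∑ σ, lowLabel t σ u * lowLabel t σ v * lowLabel t σ w +
        ((t : ℝ) - 1) * (∑ σ, lowLabel t σ w - ∑ σ, lowLabel t σ u * lowLabel t σ w -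
          ∑ σ, lowLabel t σ v * lowLabel t σ w) := by
    rw [Finset.mul_sum, ← Finset.sum_sub_distrib, ← Finset.sum_sub_distrib, Finset.mul_sum,
      ← Finset.sum_add_distrib]
    exact Finset.sum_congr rfl fun σ _ => by unfold pairWeight; ring
  have hn₁ : (n : ℝ) - 1 ≠ 0 := by
    intro h
    have h1 : n = 1 := by exact_mod_cast sub_eq_zero.1 h
    subst h1
    exact huv (Subsingleton.elim u v)
  rw [hA u] at hB hBu
  rw [hA v] at hBv
  rw [mul_left_cancel₀ hn₁ (hBu.trans hB.symm), mul_left_cancel₀ hn₁ (hBv.trans hB.symm)] at hW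
  rw [hW, sum_pairWeight, hA u, hA v]
  linear_combination (n : ℝ) * hC + ((t : ℝ) - 1) * hw - 2 * (t : ℝ) * hB

/-- `n - 2` times the contribution of an edge to `Routw`. -/
def edgeWeight {n ℓ : ℕ} (t : ℕ) (σ : Equiv.Perm (Fin n)) (e : Sym2 (Node n ℓ)) : ℝ :=
  ((n : ℝ) - t - 1) * (if ∀ x ∈ e, ((σ x.1 : ℕ) + 1 ≤ t) then 1 else 0) +
    ((t : ℝ) - 1) * (if ∀ x ∈ e, (t ≤ (σ x.1 : ℕ)) then 1 else 0)

lemma edgeWeight_mk {n ℓ : ℕ} (t : ℕ) (σ : Equiv.Perm (Fin n)) (a b : Node n ℓ) :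
    edgeWeight t σ s(a, b) = pairWeight t σ a.1 b.1 := by
  simp only [edgeWeight, pairWeight, lowLabel, Sym2.mem_iff, forall_eq_or_imp, forall_eq,
    Nat.succ_le_iff]
  by_cases ha : (σ a.1 : ℕ) < t <;> by_cases hb : (σ b.1 : ℕ) < t <;>
    simp [ha, hb, not_le.2, not_lt.1]

lemma Routw_eq_sum {n ℓ : ℕ} (Gr : Finset (Sym2 (Node n ℓ))) (t : ℕ)
    (σ : Equiv.Perm (Fin n)) :
    Routw Gr t σ = (∑ e ∈ Gout Gr, edgeWeight t σ e) / ((n : ℝ) - 2) := by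
  simp only [Routw, Rout1, Rout2, edgeWeight, Finset.sum_add_distrib, ← Finset.mul_sum,
    Finset.sum_boole]

lemma sum_Routw_mul_lowLabel {n ℓ t : ℕ} (Gr : Finset (Sym2 (Node n ℓ))) (hn : n ≠ 0)
    (ht : t ≤ n) (w : Fin n) :
    (n : ℝ) * ∑ σ, Routw Gr t σ * lowLabel t σ w = t * ∑ σ, Routw Gr t σ := by
  have hedge : ∀ e ∈ Gout Gr, (n : ℝ) * ∑ σ, edgeWeight t σ e * lowLabel t σ w =
      t * ∑ σ, edgeWeight t σ e := by
    intro e he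
    induction e using Sym2.ind with
    | _ a b =>
      have hab : a.1 ≠ b.1 := by simpa [Gout, indPair] using (Finset.mem_filter.1 he).2
      simp only [edgeWeight_mk]
      exact sum_pairWeight_mul_lowLabel hn ht hab w
  have hsum := Finset.sum_congr rfl hedge
  rw [← Finset.mul_sum, ← Finset.mul_sum, Finset.sum_comm, Finset.sum_comm (s := Gout Gr)] at hsum
  simp only [Routw_eq_sum, div_mul_eq_mul_div, ← Finset.sum_div, Finset.sum_mul]
  rw [← mul_div_assoc, ← mul_div_assoc, hsum]

lemma exists_Rin1_eq_sum {n ℓ : ℕ} (Gr : Finset (Sym2 (Node n ℓ))) :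
    ∃ ind : Sym2 (Node n ℓ) → Fin n, ∀ (t : ℕ) (σ : Equiv.Perm (Fin n)),
      (Rin1 Gr t σ : ℝ) = ∑ e ∈ Gin Gr, lowLabel t σ (ind e) := by
  refine ⟨fun e => e.out.1.1, fun t σ => ?_⟩
  rw [Rin1, ← Finset.sum_boole]
  refine Finset.sum_congr rfl fun e he => ?_
  have hdiag : (indPair e).IsDiag := (Finset.mem_filter.1 he).2
  have hout : s(e.out.1, e.out.2) = e := Quot.out_eq e
  have hfst : e.out.1.1 = e.out.2.1 := by
    rw [← hout] at hdiag
    simpa [indPair] using hdiag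
  have hmem : (∀ x ∈ e, (σ x.1 : ℕ) + 1 ≤ t) ↔ (σ e.out.1.1 : ℕ) < t := by
    conv_lhs => rw [← hout]
    simp [← hfst]
  simp only [hmem, lowLabel]

/-- The weighted between-individual edge-count statistic and the
within-individual edge-count statistic are uncorrelated under the permutation null
distribution. -/
theorem cov_Routw_Rin1 (n ℓ : ℕ) (Gr : Finset (Sym2 (Node n ℓ)))
    (hG : ∀ e ∈ Gr, ¬ e.IsDiag) (hn : 4 ≤ n) (t : ℕ) (ht1 : 1 ≤ t) (ht2 : t ≤ n - 1) :
    pcov (Routw Gr t) (fun σ => (Rin1 Gr t σ : ℝ)) = 0 := by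
  obtain ⟨ind, hind⟩ := exists_Rin1_eq_sum Gr
  have hn0 : n ≠ 0 := by omega
  have ht : t ≤ n := by omega
  have hn' : (n : ℝ) ≠ 0 := Nat.cast_ne_zero.2 hn0
  have hN : (n.factorial : ℝ) ≠ 0 := Nat.cast_ne_zero.2 n.factorial_ne_zero
  have hin : (n : ℝ) * ∑ σ, (Rin1 Gr t σ : ℝ) = (Gin Gr).card * (t * (n.factorial : ℝ)) := by
    simp only [hind]
    rw [Finset.sum_comm, Finset.mul_sum,
      Finset.sum_congr rfl fun e _ => sum_perm_lowLabel ht (ind e), Finset.sum_const, nsmul_eq_mul]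
  have hprod : (n : ℝ) * ∑ σ, Routw Gr t σ * (Rin1 Gr t σ : ℝ) =
      (Gin Gr).card * (t * ∑ σ, Routw Gr t σ) := by
    simp only [hind, Finset.mul_sum (Gin Gr)]
    rw [Finset.sum_comm, Finset.mul_sum,
      Finset.sum_congr rfl fun e _ => sum_Routw_mul_lowLabel Gr hn0 ht (ind e), Finset.sum_const,
      nsmul_eq_mul]
  rw [pcov_eq]
  simp only [pexp]
  rw [sub_eq_zero, div_mul_div_comm, div_eq_div_iff hN (mul_ne_zero hN hN)]
  refine mul_left_cancel₀ hn' ?_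
  linear_combination (n.factorial : ℝ) ^ 2 * hprod -
    (n.factorial : ℝ) * (∑ σ, Routw Gr t σ) * hin

end CPD
end
end

section
/- Under the permutation null distribution, for n ≥ 4, assuming Var(R_out,d(t)) > 0 and Var(R_in,1(t)) > 0, the orthogonalized within-individual statistic Z_in,⊥(t) = Z_in(t) − ϱ·Z_out,d(t) satisfies E(Z_in,⊥(t)) = 0 and Var(Z_in,⊥(t)) = 1 − ϱ², for every integer t with 1 ≤ t ≤ n−1. -/
open scoped BigOperators Classical

noncomputable section

namespace CPD

theorem pexp_add {n : ℕ} (f g : Equiv.Perm (Fin n) → ℝ) :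
    pexp (fun σ => f σ + g σ) = pexp f + pexp g := by
  simp only [pexp, Finset.sum_add_distrib, add_div]

theorem pexp_sub {n : ℕ} (f g : Equiv.Perm (Fin n) → ℝ) :
    pexp (fun σ => f σ - g σ) = pexp f - pexp g := by
  simp only [pexp, Finset.sum_sub_distrib, sub_div]

theorem pexp_const_mul {n : ℕ} (c : ℝ) (f : Equiv.Perm (Fin n) → ℝ) :
    pexp (fun σ => c * f σ) = c * pexp f := by
  simp only [pexp, ← Finset.mul_sum, mul_div_assoc]

theorem pexp_sum {n : ℕ} {ι : Type*} (s : Finset ι) (f : ι → Equiv.Perm (Fin n) → ℝ) :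
    pexp (fun σ => ∑ i ∈ s, f i σ) = ∑ i ∈ s, pexp (f i) := by
  simp only [pexp]
  rw [Finset.sum_comm, Finset.sum_div]

theorem pexp_const {n : ℕ} (c : ℝ) : pexp (fun _ : Equiv.Perm (Fin n) => c) = c := by
  have h : (Nat.factorial n : ℝ) ≠ 0 := by exact_mod_cast Nat.factorial_ne_zero n
  simp only [pexp, Finset.sum_const, Finset.card_univ, Fintype.card_perm, Fintype.card_fin,
    nsmul_eq_mul]
  field_simp

theorem pexp_nonneg {n : ℕ} {f : Equiv.Perm (Fin n) → ℝ} (hf : ∀ σ, 0 ≤ f σ) : 0 ≤ pexp f :=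
  div_nonneg (Finset.sum_nonneg fun σ _ => hf σ) (Nat.cast_nonneg _)

/-- The permutation distribution is invariant under right translation. -/
theorem pexp_mul_right {n : ℕ} (f : Equiv.Perm (Fin n) → ℝ) (τ : Equiv.Perm (Fin n)) :
    pexp (fun σ => f (σ * τ)) = pexp f := by
  simp only [pexp]
  exact congrArg (· / (Nat.factorial n : ℝ)) (Equiv.sum_comp (Equiv.mulRight τ) f)

theorem pvar_nonneg {n : ℕ} (f : Equiv.Perm (Fin n) → ℝ) : 0 ≤ pvar f :=
  pexp_nonneg fun _ => mul_self_nonneg _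

theorem pcov_sub_const {n : ℕ} (f g : Equiv.Perm (Fin n) → ℝ) (a b : ℝ) :
    pcov (fun σ => f σ - a) (fun σ => g σ - b) = pcov f g := by
  simp only [pcov, pexp_sub, pexp_const, sub_sub_sub_cancel_right]

/-- Residual of one standardized statistic on another: mean and variance. -/
theorem standardized_sub_mean_var {n : ℕ} (f g : Equiv.Perm (Fin n) → ℝ) (r : ℝ)
    (hf : 0 < pvar f) (hg : 0 < pvar g)
    (hr : r * (√(pvar f) * √(pvar g)) = pcov f g) :
    pexp (fun σ => (f σ - pexp f) / √(pvar f) - r * ((g σ - pexp g) / √(pvar g))) = 0 ∧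
    pvar (fun σ => (f σ - pexp f) / √(pvar f) - r * ((g σ - pexp g) / √(pvar g))) = 1 - r ^ 2 := by
  have hsf : √(pvar f) ≠ 0 := (Real.sqrt_pos.2 hf).ne'
  have hsg : √(pvar g) ≠ 0 := (Real.sqrt_pos.2 hg).ne'
  have hqf : √(pvar f) ^ 2 = pvar f := Real.sq_sqrt hf.le
  have hqg : √(pvar g) ^ 2 = pvar g := Real.sq_sqrt hg.le
  have hmean : pexp (fun σ => (f σ - pexp f) / √(pvar f) - r * ((g σ - pexp g) / √(pvar g)))
      = 0 := by
    simp only [pexp_sub, pexp_const_mul, pexp_const, div_eq_inv_mul]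
    ring
  refine ⟨hmean, ?_⟩
  rw [pvar, pcov, hmean]
  generalize √(pvar f) = a at *
  generalize √(pvar g) = b at *
  have hexp : (fun σ => ((f σ - pexp f) / a - r * ((g σ - pexp g) / b) - 0) *
        ((f σ - pexp f) / a - r * ((g σ - pexp g) / b) - 0)) =
      fun σ => (a⁻¹ ^ 2 * ((f σ - pexp f) * (f σ - pexp f)) +
        (r * b⁻¹) ^ 2 * ((g σ - pexp g) * (g σ - pexp g))) -
        (2 * r * a⁻¹ * b⁻¹) * ((f σ - pexp f) * (g σ - pexp g)) := by
    funext σ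
    ring
  rw [hexp, pexp_sub, pexp_add, pexp_const_mul, pexp_const_mul, pexp_const_mul]
  change a⁻¹ ^ 2 * pvar f + (r * b⁻¹) ^ 2 * pvar g - 2 * r * a⁻¹ * b⁻¹ * pcov f g = _
  rw [← hqf, ← hqg, ← hr]
  field_simp
  ring

/-- Indicator that the permuted label of individual `u` is at most `t`. -/
def labelInd {n : ℕ} (t : ℕ) (u : Fin n) (σ : Equiv.Perm (Fin n)) : ℝ :=
  if (σ u : ℕ) + 1 ≤ t then 1 else 0

/-- The linear statistic with weights `c` on the individuals whose permuted label is at most `t`. -/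
def linStat {n : ℕ} (t : ℕ) (c : Fin n → ℝ) (σ : Equiv.Perm (Fin n)) : ℝ :=
  ∑ u, c u * labelInd t u σ

theorem labelInd_mul {n : ℕ} (t : ℕ) (u : Fin n) (σ τ : Equiv.Perm (Fin n)) :
    labelInd t u (σ * τ) = labelInd t (τ u) σ := rfl

theorem sum_labelInd {n : ℕ} (t : ℕ) (σ : Equiv.Perm (Fin n)) :
    ∑ u, labelInd t u σ = ∑ u : Fin n, labelInd t u 1 :=
  Equiv.sum_comp σ fun u => labelInd t u 1

theorem pexp_labelInd {n : ℕ} (t : ℕ) (u v : Fin n) :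
    pexp (labelInd t u) = pexp (labelInd t v) := by
  rw [← pexp_mul_right (labelInd t u) (Equiv.swap u v)]
  simp only [labelInd_mul, Equiv.swap_apply_left]

theorem sum_labelInd_sub_pexp {n : ℕ} (t : ℕ) (σ : Equiv.Perm (Fin n)) :
    ∑ u, (labelInd t u σ - pexp (labelInd t u)) = 0 := by
  rw [Finset.sum_sub_distrib, ← pexp_sum, sum_labelInd]
  simp only [sum_labelInd, pexp_const, sub_self]

theorem pvar_labelInd {n : ℕ} (t : ℕ) (u v : Fin n) :
    pvar (labelInd t u) = pvar (labelInd t v) := by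
  rw [pvar, pcov, ← pexp_mul_right _ (Equiv.swap u v)]
  simp only [labelInd_mul, Equiv.swap_apply_left, pexp_labelInd t u v]
  rfl

theorem pcov_labelInd_right {n : ℕ} (t : ℕ) {u v w : Fin n} (hv : v ≠ u) (hw : w ≠ u) :
    pcov (labelInd t u) (labelInd t v) = pcov (labelInd t u) (labelInd t w) := by
  rw [pcov, ← pexp_mul_right _ (Equiv.swap v w)]
  simp only [labelInd_mul, Equiv.swap_apply_left, Equiv.swap_apply_of_ne_of_ne hv.symm hw.symm,
    pexp_labelInd t v w]
  rfl

theorem pcov_labelInd_of_ne {n : ℕ} (t : ℕ) {u v : Fin n} (huv : v ≠ u) :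
    ((n : ℝ) - 1) * pcov (labelInd t u) (labelInd t v) = -pvar (labelInd t u) := by
  have hsum : ∑ w, pcov (labelInd t u) (labelInd t w) = 0 := by
    simp only [pcov]
    rw [← pexp_sum]
    simp only [← Finset.mul_sum, sum_labelInd_sub_pexp, mul_zero, pexp_const]
  rw [← Finset.add_sum_erase _ _ (Finset.mem_univ u),
    Finset.sum_congr rfl fun w hw => pcov_labelInd_right t (Finset.ne_of_mem_erase hw) huv,
    Finset.sum_const, Finset.card_erase_of_mem (Finset.mem_univ u), Finset.card_univ,
    Fintype.card_fin, nsmul_eq_mul, Nat.cast_pred u.pos] at hsum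
  rw [pvar]
  linarith

theorem pcov_linStat {n : ℕ} (t : ℕ) (c d : Fin n → ℝ) :
    pcov (linStat t c) (linStat t d) =
      ∑ u, ∑ v, c u * d v * pcov (labelInd t u) (labelInd t v) := by
  have hcenter : ∀ (b : Fin n → ℝ) (σ : Equiv.Perm (Fin n)), linStat t b σ - pexp (linStat t b) =
      ∑ u, b u * (labelInd t u σ - pexp (labelInd t u)) := by
    intro b σ
    have : pexp (linStat t b) = ∑ u, b u * pexp (labelInd t u) := by
      change pexp (fun σ => ∑ u, b u * labelInd t u σ) = _
      rw [pexp_sum]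
      simp only [pexp_const_mul]
    rw [this, linStat, ← Finset.sum_sub_distrib]
    simp only [mul_sub]
  rw [pcov]
  simp only [hcenter, Finset.sum_mul_sum, mul_mul_mul_comm (c _), pexp_sum, pexp_const_mul]
  rfl

/-- Covariances of linear statistics are a fixed nonnegative multiple of the centered
inner product of their weights. -/
theorem exists_pcov_linStat_eq {n : ℕ} (hn : 2 ≤ n) (t : ℕ) :
    ∃ K : ℝ, 0 ≤ K ∧ ∀ c d : Fin n → ℝ, pcov (linStat t c) (linStat t d) =
      K * (∑ u, c u * d u - (∑ u, c u) * (∑ u, d u) / n) := by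
  have hn' : (2 : ℝ) ≤ n := by exact_mod_cast hn
  have h1 : (0 : ℝ) < n - 1 := by linarith
  have h0 : (0 : ℝ) < n := by linarith
  let o : Fin n := ⟨0, by omega⟩
  refine ⟨pvar (labelInd t o) * n / (n - 1), by have := pvar_nonneg (labelInd t o); positivity, ?_⟩
  intro c d
  have hpair : ∀ u v : Fin n, pcov (labelInd t u) (labelInd t v) =
      pvar (labelInd t o) * n / (n - 1) * ((if u = v then 1 else 0) - 1 / n) := by
    intro u v
    split_ifs with h
    · subst h
      change pvar _ = _
      rw [pvar_labelInd t u o]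
      field_simp
    · have := pcov_labelInd_of_ne t (Ne.symm h)
      rw [pvar_labelInd t u o] at this
      field_simp
      linarith
  rw [pcov_linStat, Finset.sum_mul_sum, Finset.sum_div, ← Finset.sum_sub_distrib, Finset.mul_sum]
  refine Finset.sum_congr rfl fun u _ => ?_
  have hdiag : c u * d u = ∑ v, c u * d v * (if u = v then 1 else 0) := by simp
  rw [hdiag, Finset.sum_div, ← Finset.sum_sub_distrib, Finset.mul_sum]
  refine Finset.sum_congr rfl fun v _ => ?_
  rw [hpair]
  ring

theorem sum_D_self_mul {n ℓ : ℕ} (Gr : Finset (Sym2 (Node n ℓ))) (f : Fin n → ℝ) :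
    ∑ u, (D Gr u u : ℝ) * f u = ∑ e ∈ Gin Gr, ∑ u, if indPair e = s(u, u) then f u else 0 := by
  rw [Finset.sum_comm]
  refine Finset.sum_congr rfl fun u _ => ?_
  rw [D, Gin, Finset.sum_filter, Finset.card_filter]
  push_cast
  rw [Finset.sum_mul]
  refine Finset.sum_congr rfl fun e _ => ?_
  by_cases h : indPair e = s(u, u) <;> simp [h]

theorem sum_Ddeg_mul {n ℓ : ℕ} (Gr : Finset (Sym2 (Node n ℓ))) (f : Fin n → ℝ) :
    ∑ u, (Ddeg Gr u : ℝ) * f u = ∑ e ∈ Gout Gr, ∑ u, if u ∈ indPair e then f u else 0 := by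
  rw [Finset.sum_comm]
  refine Finset.sum_congr rfl fun u _ => ?_
  have hD : (Ddeg Gr u : ℝ) =
      ∑ e ∈ Gr, ∑ v ∈ Finset.univ.filter (· ≠ u), if indPair e = s(u, v) then (1 : ℝ) else 0 := by
    rw [Finset.sum_comm, Ddeg]
    simp only [D, Finset.card_filter]
    push_cast
    rfl
  rw [hD, Gout, Finset.sum_filter, Finset.sum_mul]
  refine Finset.sum_congr rfl fun e _ => ?_
  generalize indPair e = p
  by_cases hu : u ∈ p
  · obtain ⟨w, rfl⟩ := hu
    by_cases hw : u = w
    · subst hw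
      rw [Finset.sum_eq_zero]
      · simp
      · intro v hv
        have hvu : u ≠ v := (Finset.mem_filter.1 hv).2.symm
        simp [hvu]
    · simp [hw, Ne.symm hw, Finset.sum_ite_eq]
  · rw [Finset.sum_eq_zero]
    · simp [hu]
    · intro v _
      exact if_neg fun h : p = s(u, v) => hu (h ▸ Sym2.mem_mk_left u v)

theorem sum_D_self {n ℓ : ℕ} (Gr : Finset (Sym2 (Node n ℓ))) :
    ∑ u, (D Gr u u : ℝ) = (Gin Gr).card := by
  have h := sum_D_self_mul Gr fun _ => 1
  simp only [mul_one] at h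
  rw [h, Finset.card_eq_sum_ones]
  push_cast
  refine Finset.sum_congr rfl fun e he => ?_
  have hd := (Finset.mem_filter.1 he).2
  generalize indPair e = p at hd
  induction p with | h x y =>
  obtain rfl : x = y := hd
  simp

theorem sum_Ddeg {n ℓ : ℕ} (Gr : Finset (Sym2 (Node n ℓ))) :
    ∑ u, (Ddeg Gr u : ℝ) = 2 * (Gout Gr).card := by
  have h := sum_Ddeg_mul Gr fun _ => 1
  simp only [mul_one] at h
  rw [h, mul_comm, ← nsmul_eq_mul]
  refine Finset.sum_eq_card_nsmul fun e he => ?_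
  have hd := (Finset.mem_filter.1 he).2
  generalize indPair e = p at hd
  induction p with | h x y =>
  have hxy : x ≠ y := hd
  have hs : (Finset.univ.filter fun u => u = x ∨ u = y) = {x, y} := by ext; simp
  simp [hs, Finset.card_pair hxy]

theorem Rin1_eq_linStat {n ℓ : ℕ} (Gr : Finset (Sym2 (Node n ℓ))) (t : ℕ) :
    (fun σ => (Rin1 Gr t σ : ℝ)) = linStat t fun u => (D Gr u u : ℝ) := by
  funext σ
  rw [linStat, sum_D_self_mul, Rin1, Finset.card_filter]
  push_cast
  refine Finset.sum_congr rfl fun e he => ?_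
  have hd := (Finset.mem_filter.1 he).2
  induction e with | h x y =>
  have hxy : x.1 = y.1 := hd
  simp [indPair, hxy, labelInd]

theorem Routd_eq_linStat {n ℓ : ℕ} (Gr : Finset (Sym2 (Node n ℓ))) (t : ℕ) :
    Routd Gr t = fun σ => linStat t (fun u => (Ddeg Gr u : ℝ)) σ - (Gout Gr).card := by
  funext σ
  rw [Routd, linStat, sum_Ddeg_mul, Rout1, Rout2, Finset.card_filter, Finset.card_filter,
    Finset.card_eq_sum_ones]
  push_cast
  rw [← Finset.sum_sub_distrib, ← Finset.sum_sub_distrib]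
  refine Finset.sum_congr rfl fun e he => ?_
  have hd := (Finset.mem_filter.1 he).2
  induction e with | h x y =>
  have hxy : x.1 ≠ y.1 := hd
  have hs : (Finset.univ.filter fun u => u = x.1 ∨ u = y.1) = {x.1, y.1} := by ext; simp
  simp only [indPair, Sym2.map_mk, Sym2.mem_iff, ← Finset.sum_filter, hs, Finset.sum_pair hxy,
    forall_eq_or_imp, forall_eq, labelInd]
  by_cases h1 : (σ x.1 : ℕ) + 1 ≤ t <;> by_cases h2 : (σ y.1 : ℕ) + 1 ≤ t <;>
    simp [h1, h2, show (t ≤ (σ x.1 : ℕ)) ↔ ¬ (σ x.1 : ℕ) + 1 ≤ t by omega,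
      show (t ≤ (σ y.1 : ℕ)) ↔ ¬ (σ y.1 : ℕ) + 1 ≤ t by omega]

theorem varrho_mul_sqrt_pvar {n ℓ : ℕ} (Gr : Finset (Sym2 (Node n ℓ))) (hn : 2 ≤ n) (t : ℕ)
    (hvd : 0 < pvar (Routd Gr t)) (hvi : 0 < pvar (fun σ => (Rin1 Gr t σ : ℝ))) :
    varrho Gr * (√(pvar fun σ => (Rin1 Gr t σ : ℝ)) * √(pvar (Routd Gr t))) =
      pcov (fun σ => (Rin1 Gr t σ : ℝ)) (Routd Gr t) := by
  obtain ⟨K, hK, hcov⟩ := exists_pcov_linStat_eq hn t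
  set a : Fin n → ℝ := fun u => (D Gr u u : ℝ)
  set b : Fin n → ℝ := fun u => (Ddeg Gr u : ℝ)
  have hdd : pvar (Routd Gr t) = K * (∑ u, (Ddeg Gr u : ℝ) ^ 2 -
      4 * ((Gout Gr).card : ℝ) ^ 2 / n) := by
    rw [Routd_eq_linStat, pvar, pcov_sub_const, hcov, sum_Ddeg]
    simp only [← sq]
    ring
  have hii : pvar (fun σ => (Rin1 Gr t σ : ℝ)) = K * (∑ u, (D Gr u u : ℝ) ^ 2 -
      ((Gin Gr).card : ℝ) ^ 2 / n) := by
    rw [Rin1_eq_linStat, pvar, hcov, sum_D_self]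
    simp only [← sq]
  have hid : pcov (fun σ => (Rin1 Gr t σ : ℝ)) (Routd Gr t) =
      K * (∑ u, (D Gr u u : ℝ) * (Ddeg Gr u : ℝ) -
        2 / (n : ℝ) * ((Gin Gr).card : ℝ) * ((Gout Gr).card : ℝ)) := by
    have h := pcov_sub_const (linStat t a) (linStat t b) 0 (Gout Gr).card
    simp only [sub_zero] at h
    rw [Rin1_eq_linStat, Routd_eq_linStat]
    refine h.trans ?_
    rw [hcov, sum_D_self, sum_Ddeg]
    ring
  rw [hdd] at hvd
  rw [hii] at hvi
  have hSd := pos_of_mul_pos_right hvd hK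
  have hSi := pos_of_mul_pos_right hvi hK
  rw [hid, hdd, hii, varrho, ← Real.sqrt_mul hvi.le, Real.sqrt_mul hSd.le]
  have hsq : ∀ x y : ℝ, K * x * (K * y) = K ^ 2 * (x * y) := fun x y => by ring
  rw [hsq, Real.sqrt_mul (sq_nonneg K), Real.sqrt_sq hK, Real.sqrt_mul hSi.le]
  have h1 := (Real.sqrt_pos.2 hSd).ne'
  have h2 := (Real.sqrt_pos.2 hSi).ne'
  generalize √(∑ u, (Ddeg Gr u : ℝ) ^ 2 - 4 * ((Gout Gr).card : ℝ) ^ 2 / n) = x at *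
  generalize √(∑ u, (D Gr u u : ℝ) ^ 2 - ((Gin Gr).card : ℝ) ^ 2 / n) = y at *
  generalize (_ - _ : ℝ) = z
  field_simp

/-- The orthogonalized within-individual statistic
`Z_in,⊥(t) = Z_in(t) − ϱ·Z_out,d(t)` has mean `0` and variance `1 − ϱ²` under the permutation
null distribution. -/
theorem orthogonalized_mean_var (n ℓ : ℕ) (Gr : Finset (Sym2 (Node n ℓ)))
    (hG : ∀ e ∈ Gr, ¬ e.IsDiag) (hn : 4 ≤ n)
    (t : ℕ) (ht1 : 1 ≤ t) (ht2 : t ≤ n - 1)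
    (hvd : 0 < pvar (Routd Gr t)) (hvi : 0 < pvar (fun σ => (Rin1 Gr t σ : ℝ))) :
    pexp (fun σ => Zin Gr t σ - varrho Gr * Zoutd Gr t σ) = 0 ∧
    pvar (fun σ => Zin Gr t σ - varrho Gr * Zoutd Gr t σ) = 1 - varrho Gr ^ 2 := by
  exact standardized_sub_mean_var _ _ _ hvi hvd (varrho_mul_sqrt_pvar Gr (by omega) t hvd hvi)

end CPD
end
end
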